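/- arXiv:1702.05894 — 2 statements merged into one kernel-verified Lean document; each statement's English description precedes it below -/
import Mathlib

section
/- Let n be a positive integer, 1 ≤ d ≤ n, and let f : [0, ∞) → [0, ∞) be monotone decreasing with f(0) = 1 and ∫₀^∞ f(t) t^{d−1} dt < ∞. Let X = {x_j : j ∈ ℕ} ⊂ ℝⁿ be a set of distinct points with separation δ = inf_{j ≠ k} |x_j − x_k| > 0 whose linear span has dimension d. Then for every square-summable complex sequence (a_j), Σ_{j,k ∈ ℕ} f(|x_j − x_k|) |a_j| |a_k| ≤ (1 + (d(5^d − 1)/δ^d) ∫₀^∞ f(t) t^{d−1} dt) · Σ_{j ∈ ℕ} |a_j|². -/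
open MeasureTheory Real Set

/-- Packing bound: `δ`-separated points in a closed ball of radius `r`. -/
theorem card_mul_pow_le_of_separated {E ι : Type*} [NormedAddCommGroup E] [NormedSpace ℝ E]
    [FiniteDimensional ℝ E] (S : Finset ι) (z : ι → E) (c : E) {r δ : ℝ} (hr : 0 ≤ r) (hδ : 0 < δ)
    (hsep : ∀ i ∈ S, ∀ j ∈ S, i ≠ j → δ ≤ ‖z i - z j‖) (hball : ∀ i ∈ S, ‖z i - c‖ ≤ r) :
    (S.card : ℝ) * (δ / 2) ^ Module.finrank ℝ E ≤ (r + δ / 2) ^ Module.finrank ℝ E := by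
  borelize E
  let μ : Measure E := Measure.addHaar
  have hδ2 : 0 < δ / 2 := by positivity
  have hdisj : Set.Pairwise (S : Set ι)
      (Function.onFun Disjoint fun i => Metric.ball (z i) (δ / 2)) := by
    intro i hi j hj hij
    refine Metric.ball_disjoint_ball ?_
    rw [dist_eq_norm]
    linarith [hsep i hi j hj hij]
  have hsub : (⋃ i ∈ S, Metric.ball (z i) (δ / 2)) ⊆ Metric.ball c (r + δ / 2) := by
    refine Set.iUnion₂_subset fun i hi => Metric.ball_subset_ball' ?_
    rw [dist_eq_norm]
    linarith [hball i hi]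
  have hle : (S.card : ENNReal) * ENNReal.ofReal ((δ / 2) ^ Module.finrank ℝ E) *
      μ (Metric.ball 0 1) ≤
        ENNReal.ofReal ((r + δ / 2) ^ Module.finrank ℝ E) * μ (Metric.ball 0 1) := by
    calc
      _ = μ (⋃ i ∈ S, Metric.ball (z i) (δ / 2)) := by
        rw [measure_biUnion_finset hdisj fun i _ => Metric.isOpen_ball.measurableSet]
        simp only [Measure.addHaar_ball_of_pos μ _ hδ2, Finset.sum_const, nsmul_eq_mul, mul_assoc]
      _ ≤ μ (Metric.ball c (r + δ / 2)) := measure_mono hsub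
      _ = _ := Measure.addHaar_ball_of_pos μ _ (by positivity)
  have hcard := (ENNReal.mul_le_mul_iff_left
    (Metric.measure_ball_pos μ _ zero_lt_one).ne' measure_ball_lt_top.ne).1 hle
  rwa [← ENNReal.ofReal_natCast, ← ENNReal.ofReal_mul (Nat.cast_nonneg _),
    ENNReal.ofReal_le_ofReal_iff (by positivity)] at hcard

theorem two_mul_add_one_pow_le {s : ℝ} (hs : 1 ≤ s) (d : ℕ) :
    (2 * s + 1) ^ d ≤ ((3 : ℝ) ^ d - 1) * s ^ d + 1 := by
  induction d with
  | zero => simp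
  | succ d ih =>
    have h3 : (0 : ℝ) ≤ 3 ^ d - 1 := sub_nonneg.2 (one_le_pow₀ (by norm_num))
    have hsd : s ^ d ≤ s ^ (d + 1) := pow_le_pow_right₀ hs (Nat.le_succ d)
    have hs1 : s ≤ s ^ (d + 1) := le_self_pow₀ hs (Nat.succ_ne_zero d)
    calc
      (2 * s + 1) ^ (d + 1) = (2 * s + 1) ^ d * (2 * s + 1) := pow_succ _ _
      _ ≤ (((3 : ℝ) ^ d - 1) * s ^ d + 1) * (2 * s + 1) := by gcongr
      _ = 2 * ((3 : ℝ) ^ d - 1) * s ^ (d + 1) + (3 ^ d - 1) * s ^ d + 2 * s + 1 := by ring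
      _ ≤ 2 * ((3 : ℝ) ^ d - 1) * s ^ (d + 1) + (3 ^ d - 1) * s ^ (d + 1) +
          2 * s ^ (d + 1) + 1 := by gcongr
      _ = ((3 : ℝ) ^ (d + 1) - 1) * s ^ (d + 1) + 1 := by ring

/-- Distances from a point `c` to the other points of a `δ`-separated family. -/
theorem card_le_of_separated_of_dist {E ι : Type*} [NormedAddCommGroup E] [NormedSpace ℝ E]
    [FiniteDimensional ℝ E] (S : Finset ι) (z : ι → E) (j : ι) (hj : j ∉ S) {r δ : ℝ}
    (hr : δ ≤ r) (hδ : 0 < δ) (hsep : ∀ i k : ι, i ≠ k → δ ≤ ‖z i - z k‖)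
    (hball : ∀ i ∈ S, ‖z j - z i‖ ≤ r) :
    (S.card : ℝ) ≤ ((3 : ℝ) ^ Module.finrank ℝ E - 1) / δ ^ Module.finrank ℝ E *
      r ^ Module.finrank ℝ E := by
  classical
  have hpack := card_mul_pow_le_of_separated (insert j S) z (z j) (hδ.le.trans hr) hδ
    (fun i _ k _ hik => hsep i k hik) (by
      intro i hi
      rw [norm_sub_rev]
      rcases Finset.mem_insert.1 hi with rfl | hi
      · simpa using hδ.le.trans hr
      · exact hball i hi)
  rw [Finset.card_insert_of_notMem hj] at hpack
  have hs : 1 ≤ r / δ := (one_le_div hδ).2 hr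
  have heq : r + δ / 2 = (2 * (r / δ) + 1) * (δ / 2) := by field_simp
  rw [heq, mul_pow] at hpack
  have hcard := (le_of_mul_le_mul_right hpack (by positivity)).trans
    (two_mul_add_one_pow_le hs _)
  push_cast at hcard
  rw [div_pow, ← mul_div_assoc] at hcard
  rw [div_mul_eq_mul_div]
  linarith

/-- Comparison of a sum over points with at most polynomially many points in balls
with the corresponding radial integral. -/
theorem sum_le_intervalIntegral_of_card_le {ι : Type*} {d : ℕ} (hd : d ≠ 0) {f : ℝ → ℝ}
    (hf : AntitoneOn f (Ici 0))
    (hint : IntegrableOn (fun t : ℝ => f t * t ^ (d - 1)) (Ioi 0)) {C : ℝ} (hC : 0 < C)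
    (r : ι → ℝ) (hr : ∀ i, 0 ≤ r i) (S : Finset ι)
    (hS : ∀ i ∈ S, ((S.filter fun k => r k ≤ r i).card : ℝ) ≤ C * r i ^ d) :
    ∀ y : ℝ, 0 ≤ y → C * y ^ d = S.card →
      ∑ i ∈ S, f (r i) ≤ C * d * ∫ t in (0 : ℝ)..y, f t * t ^ (d - 1) := by
  classical
  induction S using Finset.induction_on_max_value r with
  | empty =>
    intro y hy hCy
    have : y = 0 := by simpa [hC.ne', hd] using hCy
    simp [this]
  | insert m S hm hmax ih =>
    intro y hy hCy
    rw [Finset.card_insert_of_notMem hm] at hCy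
    push_cast at hCy
    set w : ℝ := ((S.card : ℝ) / C) ^ ((d : ℝ)⁻¹) with hw
    have hw0 : 0 ≤ w := by positivity
    have hwd : C * w ^ d = S.card := by
      rw [hw, rpow_inv_natCast_pow (by positivity) hd]
      field_simp
    have hwy : w ≤ y := by
      refine (pow_le_pow_iff_left₀ hw0 hy hd).1 (le_of_mul_le_mul_left ?_ hC)
      linarith
    have hyr : y ≤ r m := by
      refine (pow_le_pow_iff_left₀ hy (hr m) hd).1 (le_of_mul_le_mul_left ?_ hC)
      have h := hS m (Finset.mem_insert_self m S)
      rw [Finset.filter_true_of_mem (by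
        intro k hk
        rcases Finset.mem_insert.1 hk with rfl | hk
        · exact le_rfl
        · exact hmax k hk), Finset.card_insert_of_notMem hm] at h
      push_cast at h
      linarith
    have hii : ∀ u v : ℝ, 0 ≤ u → u ≤ v →
        IntervalIntegrable (fun t : ℝ => f t * t ^ (d - 1)) volume u v := by
      intro u v hu huv
      rw [intervalIntegrable_iff_integrableOn_Ioc_of_le huv]
      exact hint.mono_set fun t ht => hu.trans_lt ht.1
    have hlast : f (r m) * ((y ^ d - w ^ d) / d) ≤ ∫ t in w..y, f t * t ^ (d - 1) := by
      have hpow : ∫ t in w..y, t ^ (d - 1) = (y ^ d - w ^ d) / d := by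
        obtain ⟨e, rfl⟩ := Nat.exists_eq_succ_of_ne_zero hd
        simp [integral_pow]
      rw [← hpow, ← intervalIntegral.integral_const_mul]
      refine intervalIntegral.integral_mono_on hwy
        (Continuous.intervalIntegrable (by fun_prop) _ _) (hii w y hw0 hwy) fun t ht => ?_
      have ht0 : 0 ≤ t := hw0.trans ht.1
      exact mul_le_mul_of_nonneg_right (hf ht0 (hr m) (ht.2.trans hyr)) (by positivity)
    have hprev := ih (fun i hi => le_trans (by
      gcongr
      exact Finset.subset_insert m S) (hS i (Finset.mem_insert_of_mem hi))) w hw0 hwd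
    have hd0 : (d : ℝ) ≠ 0 := Nat.cast_ne_zero.2 hd
    have hone : C * d * (f (r m) * ((y ^ d - w ^ d) / d)) = f (r m) := by
      have : C * (y ^ d - w ^ d) = 1 := by linarith
      field_simp
      linear_combination f (r m) * this
    rw [Finset.sum_insert hm, ← intervalIntegral.integral_add_adjacent_intervals
      (hii 0 w le_rfl hw0) (hii w y hw0 hwy), mul_add]
    have := mul_le_mul_of_nonneg_left hlast (by positivity : (0 : ℝ) ≤ C * d)
    linarith

theorem sum_le_integral_of_card_le {ι : Type*} {d : ℕ} (hd : d ≠ 0) {f : ℝ → ℝ}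
    (hf_nonneg : ∀ t : ℝ, 0 ≤ t → 0 ≤ f t) (hf : AntitoneOn f (Ici 0))
    (hint : IntegrableOn (fun t : ℝ => f t * t ^ (d - 1)) (Ioi 0)) {C : ℝ} (hC : 0 < C)
    (r : ι → ℝ) (hr : ∀ i, 0 ≤ r i) (S : Finset ι)
    (hS : ∀ i ∈ S, ((S.filter fun k => r k ≤ r i).card : ℝ) ≤ C * r i ^ d) :
    ∑ i ∈ S, f (r i) ≤ C * d * ∫ t in Ioi (0 : ℝ), f t * t ^ (d - 1) := by
  have hy0 : 0 ≤ ((S.card : ℝ) / C) ^ ((d : ℝ)⁻¹) := by positivity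
  refine (sum_le_intervalIntegral_of_card_le hd hf hint hC r hr S hS _ hy0 ?_).trans ?_
  · rw [rpow_inv_natCast_pow (by positivity) hd]
    field_simp
  · rw [intervalIntegral.integral_of_le hy0]
    refine mul_le_mul_of_nonneg_left ?_ (by positivity)
    refine setIntegral_mono_set hint ?_ (LE.le.eventuallyLE Ioc_subset_Ioi_self)
    refine (ae_restrict_iff' measurableSet_Ioi).2 (Filter.Eventually.of_forall fun t ht => ?_)
    exact mul_nonneg (hf_nonneg t (le_of_lt ht)) (pow_nonneg (le_of_lt ht) _)

/-- Schur's test for a symmetric nonnegative kernel with row sums bounded by `B`. -/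
theorem tsum_tsum_mul_le_of_row_sum_le {ι : Type*} {K : ι → ι → ℝ} {B : ℝ}
    (hK : ∀ j k, 0 ≤ K j k) (hsymm : ∀ j k, K j k = K k j)
    (hB : ∀ (j : ι) (S : Finset ι), ∑ k ∈ S, K j k ≤ B) {b : ι → ℝ}
    (hb : ∀ j, 0 ≤ b j) (hb2 : Summable fun j => b j ^ 2) :
    ∑' j, ∑' k, K j k * b j * b k ≤ B * ∑' j, b j ^ 2 := by
  classical
  have hnonneg : ∀ p : ι × ι, 0 ≤ K p.1 p.2 * b p.1 * b p.2 := fun p =>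
    mul_nonneg (mul_nonneg (hK _ _) (hb _)) (hb _)
  have hsquare : ∀ J : Finset ι, ∑ j ∈ J, ∑ k ∈ J, K j k * b j * b k ≤
      B * ∑' j, b j ^ 2 := by
    intro J
    have hrow : ∑ j ∈ J, ∑ k ∈ J, K j k * b j ^ 2 ≤ B * ∑' j, b j ^ 2 := by
      rcases isEmpty_or_nonempty ι with h | ⟨⟨j⟩⟩
      · simp [J.eq_empty_of_isEmpty]
      have hB0 : 0 ≤ B := by simpa using hB j ∅
      calc
        _ ≤ ∑ j ∈ J, B * b j ^ 2 := by
          refine Finset.sum_le_sum fun j _ => ?_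
          rw [← Finset.sum_mul]
          exact mul_le_mul_of_nonneg_right (hB j J) (sq_nonneg _)
        _ = B * ∑ j ∈ J, b j ^ 2 := (Finset.mul_sum _ _ _).symm
        _ ≤ _ := mul_le_mul_of_nonneg_left (hb2.sum_le_tsum J fun j _ => sq_nonneg _) hB0
    have hcol : ∑ j ∈ J, ∑ k ∈ J, K j k * b k ^ 2 = ∑ j ∈ J, ∑ k ∈ J, K j k * b j ^ 2 := by
      rw [Finset.sum_comm]
      exact Finset.sum_congr rfl fun j _ => Finset.sum_congr rfl fun k _ => by rw [hsymm]
    calc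
      _ ≤ ∑ j ∈ J, ∑ k ∈ J, (K j k * b j ^ 2 + K j k * b k ^ 2) / 2 := by
        refine Finset.sum_le_sum fun j _ => Finset.sum_le_sum fun k _ => ?_
        nlinarith [mul_nonneg (hK j k) (sq_nonneg (b j - b k))]
      _ = ∑ j ∈ J, ∑ k ∈ J, K j k * b j ^ 2 := by
        simp only [← Finset.sum_div, Finset.sum_add_distrib, hcol]
        ring
      _ ≤ _ := hrow
  have hfin : ∀ T : Finset (ι × ι), ∑ p ∈ T, K p.1 p.2 * b p.1 * b p.2 ≤
      B * ∑' j, b j ^ 2 := by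
    intro T
    let J := T.image Prod.fst ∪ T.image Prod.snd
    have hT : T ⊆ J ×ˢ J := fun p hp => Finset.mem_product.2
      ⟨Finset.mem_union_left _ (Finset.mem_image_of_mem _ hp),
        Finset.mem_union_right _ (Finset.mem_image_of_mem _ hp)⟩
    refine (Finset.sum_le_sum_of_subset_of_nonneg hT fun p _ _ => hnonneg p).trans ?_
    rw [Finset.sum_product]
    exact hsquare J
  have hsum := summable_of_sum_le hnonneg hfin
  rw [← hsum.tsum_prod]
  exact hsum.tsum_le_of_sum_le hfin

theorem schoenberg_quadratic_form_bound (n d : ℕ) (hn : 0 < n) (hd1 : 1 ≤ d) (hdn : d ≤ n)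
    (f : ℝ → ℝ) (hf_nonneg : ∀ t : ℝ, 0 ≤ t → 0 ≤ f t)
    (hf_mono : AntitoneOn f (Ici 0)) (hf0 : f 0 = 1)
    (hf_int : IntegrableOn (fun t : ℝ => f t * t ^ ((d : ℝ) - 1)) (Ioi 0))
    (x : ℕ → EuclideanSpace ℝ (Fin n)) (δ : ℝ) (hδ : 0 < δ)
    (hsep : ∀ j k : ℕ, j ≠ k → δ ≤ ‖x j - x k‖)
    (hspan : Module.finrank ℝ (Submodule.span ℝ (Set.range x)) = d)
    (a : ℕ → ℂ) (ha : Summable fun j : ℕ => ‖a j‖ ^ 2) :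
    (∑' j : ℕ, ∑' k : ℕ, f ‖x j - x k‖ * ‖a j‖ * ‖a k‖) ≤
      (1 + ((d : ℝ) * ((5 : ℝ) ^ d - 1) / δ ^ d) *
          ∫ t in Ioi (0 : ℝ), f t * t ^ ((d : ℝ) - 1)) *
        ∑' j : ℕ, ‖a j‖ ^ 2 := by
  have hd : d ≠ 0 := Nat.one_le_iff_ne_zero.1 hd1
  have hpow : ∀ t ∈ Ioi (0 : ℝ), f t * t ^ ((d : ℝ) - 1) = f t * t ^ (d - 1) := by
    intro t _
    rw [← rpow_natCast, Nat.cast_pred hd1]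
  rw [setIntegral_congr_fun measurableSet_Ioi hpow]
  rw [integrableOn_congr_fun hpow measurableSet_Ioi] at hf_int
  have hI : 0 ≤ ∫ t in Ioi (0 : ℝ), f t * t ^ (d - 1) :=
    setIntegral_nonneg measurableSet_Ioi fun t ht =>
      mul_nonneg (hf_nonneg t (le_of_lt ht)) (pow_nonneg (le_of_lt ht) _)
  refine tsum_tsum_mul_le_of_row_sum_le (fun j k => hf_nonneg _ (norm_nonneg _))
    (fun j k => by rw [norm_sub_rev]) (fun j S => ?_) (fun j => norm_nonneg (a j)) ha
  let z : ℕ → Submodule.span ℝ (Set.range x) := fun i =>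
    ⟨x i, Submodule.subset_span (Set.mem_range_self i)⟩
  have hoff : ∑ k ∈ S.erase j, f ‖x j - x k‖ ≤
      ((3 : ℝ) ^ d - 1) / δ ^ d * d * ∫ t in Ioi (0 : ℝ), f t * t ^ (d - 1) := by
    have h3 : (0 : ℝ) < 3 ^ d - 1 := sub_pos.2 (one_lt_pow₀ (by norm_num) hd)
    refine sum_le_integral_of_card_le hd hf_nonneg hf_mono hf_int (by positivity)
      (fun k => ‖x j - x k‖) (fun k => norm_nonneg _) _ fun i hi => ?_
    have hcard := card_le_of_separated_of_dist
      ((S.erase j).filter fun k => ‖x j - x k‖ ≤ ‖x j - x i‖) z j (by simp)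
      (hsep j i (Finset.ne_of_mem_erase hi).symm) hδ hsep
      (fun k hk => (Finset.mem_filter.1 hk).2)
    rwa [hspan] at hcard
  have hdiag : ∑ k ∈ S, f ‖x j - x k‖ ≤ 1 + ∑ k ∈ S.erase j, f ‖x j - x k‖ := by
    refine (Finset.sum_le_sum_of_subset_of_nonneg (Finset.insert_erase_subset j S)
      fun k _ _ => hf_nonneg _ (norm_nonneg _)).trans ?_
    rw [Finset.sum_insert (Finset.notMem_erase j S)]
    simp [hf0]
  refine (hdiag.trans (add_le_add_right hoff 1)).trans ?_
  rw [div_mul_eq_mul_div, mul_comm _ (d : ℝ)]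
  gcongr
  norm_num
end

section
/- Let β > 1/2 and let X = {x_j : j ∈ ℕ} ⊂ ℝ be a set of distinct real numbers with separation δ = inf_{j ≠ k} |x_j − x_k| satisfying δ > 2 B(β − 1/2, 1/2). Then with θ = 2 B(β − 1/2, 1/2)/δ < 1, for every square-summable complex sequence (a_j) one has Re( Σ_{j,k ∈ ℕ} (1 + |x_j − x_k|²)^{−β} a_j conj(a_k) ) ≥ (1 − θ) Σ_{j ∈ ℕ} |a_j|²; in particular the Schoenberg matrix [(1 + |x_j − x_k|²)^{−β}]_{j,k} defines a bounded invertible operator on ℓ²(ℕ). -/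
open MeasureTheory Real Set

/-- The Euler Beta function. -/
noncomputable def matBeta (a b : ℝ) : ℝ :=
  ∫ t in (0 : ℝ)..1, t ^ (a - 1) * (1 - t) ^ (b - 1)

theorem integrable_one_add_sq_abs_rpow_neg {β : ℝ} (hβ : 1 / 2 < β) :
    Integrable (fun y : ℝ => (1 + |y| ^ 2) ^ (-β)) := by
  have h := integrable_rpow_neg_one_add_norm_sq (E := ℝ) (μ := volume) (r := 2 * β)
    (by rw [Module.finrank_self]; push_cast; linarith)
  refine h.congr (Filter.Eventually.of_forall fun y => ?_)
  simp only [Real.norm_eq_abs]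
  congr 1
  ring

theorem image_inv_one_add_sq_Ioi :
    (fun s : ℝ => (1 + s ^ 2)⁻¹) '' Ioi 0 = Ioo 0 1 := by
  ext t
  constructor
  · rintro ⟨s, hs, rfl⟩
    have hs : 0 < s := hs
    exact ⟨by positivity, inv_lt_one_of_one_lt₀ (by nlinarith)⟩
  · rintro ⟨h0, h1⟩
    have h : 0 < t⁻¹ - 1 := sub_pos.2 ((one_lt_inv₀ h0).2 h1)
    refine ⟨√(t⁻¹ - 1), Real.sqrt_pos.2 h, ?_⟩
    simp only [Real.sq_sqrt h.le]
    rw [add_sub_cancel, inv_inv]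

theorem injOn_inv_one_add_sq_Ioi : InjOn (fun s : ℝ => (1 + s ^ 2)⁻¹) (Ioi 0) := by
  intro s hs t ht h
  have h' : s ^ 2 = t ^ 2 := by simpa using h
  exact (sq_eq_sq₀ (le_of_lt hs) (le_of_lt ht)).1 h'

/-- The integral of the inverse multiquadric over the line is a Beta value. -/
theorem integral_one_add_sq_abs_rpow_neg (β : ℝ) :
    ∫ y : ℝ, (1 + |y| ^ 2) ^ (-β) = matBeta (β - 1 / 2) (1 / 2) := by
  rw [integral_comp_abs (f := fun r => (1 + r ^ 2) ^ (-β)), matBeta,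
    intervalIntegral.integral_of_le zero_le_one, integral_Ioc_eq_integral_Ioo,
    ← image_inv_one_add_sq_Ioi,
    integral_image_eq_integral_abs_deriv_smul (f' := fun s => -(2 * s) / (1 + s ^ 2) ^ 2)
      measurableSet_Ioi _ injOn_inv_one_add_sq_Ioi, ← integral_const_mul]
  · refine setIntegral_congr_fun measurableSet_Ioi fun s hs => ?_
    have hs : 0 < s := hs
    have hp : 0 < 1 + s ^ 2 := by positivity
    have h1 : 1 - (1 + s ^ 2)⁻¹ = s ^ 2 * (1 + s ^ 2)⁻¹ := by
      field_simp
      ring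
    have h2 : (s ^ 2) ^ ((1 : ℝ) / 2 - 1) = s⁻¹ := by
      rw [← Real.rpow_natCast s 2, ← Real.rpow_mul hs.le, ← Real.rpow_neg_one]
      norm_num
    have h3 : |-(2 * s) / (1 + s ^ 2) ^ 2| = 2 * s * (1 + s ^ 2) ^ (-2 : ℝ) := by
      rw [abs_div, abs_neg, abs_of_pos (by positivity : 0 < 2 * s), abs_of_pos (pow_pos hp 2),
        Real.rpow_neg hp.le, Real.rpow_two, div_eq_mul_inv]
    have h4 : (1 + s ^ 2) ^ (-β) = (1 + s ^ 2) ^ (-2 : ℝ) *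
        ((1 + s ^ 2) ^ (-(β - 1 / 2 - 1)) * (1 + s ^ 2) ^ (-((1 : ℝ) / 2 - 1))) := by
      rw [← Real.rpow_add hp, ← Real.rpow_add hp]
      ring_nf
    simp only [smul_eq_mul]
    rw [h1, h3, Real.mul_rpow (by positivity) (by positivity), h2, Real.inv_rpow hp.le,
      Real.inv_rpow hp.le, ← Real.rpow_neg hp.le, ← Real.rpow_neg hp.le, h4]
    field_simp
  · intro s _
    have hp : (1 + s ^ 2) ≠ 0 := by positivity
    have h : HasDerivAt (fun s : ℝ => 1 + s ^ 2) (2 * s) s := by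
      simpa using (hasDerivAt_pow 2 s).const_add 1
    exact (h.fun_inv hp).hasDerivWithinAt

/-- A packing estimate: a radially decreasing function summed over separated points is bounded by
its integral. -/
theorem sum_le_integral_of_separated {ι : Type*} (s : Finset ι) (u : ι → ℝ) {F : ℝ → ℝ}
    (hF : AntitoneOn F (Ici 0)) (hF0 : ∀ r, 0 ≤ r → 0 ≤ F r)
    (hint : Integrable (fun y => F |y|)) {δ : ℝ} (hδ : 0 < δ)
    (hu : ∀ k ∈ s, δ / 2 ≤ |u k|)
    (hsep : ∀ j ∈ s, ∀ k ∈ s, j ≠ k → δ ≤ |u j - u k|) :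
    δ / 2 * ∑ k ∈ s, F |u k| ≤ ∫ y, F |y| := by
  set I : ι → Set ℝ := fun k =>
    if 0 < u k then Ioo (u k - δ / 2) (u k) else Ioo (u k) (u k + δ / 2) with hI
  have hmeas : ∀ k, MeasurableSet (I k) := fun k => by
    simp only [hI]; split_ifs <;> exact measurableSet_Ioo
  have hvol : ∀ k, volume (I k) = ENNReal.ofReal (δ / 2) := fun k => by
    simp only [hI]; split_ifs <;> rw [Real.volume_Ioo] <;> ring_nf
  have hnear : ∀ k, ∀ y ∈ I k, |y - u k| < δ / 2 := fun k y hy => by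
    simp only [hI] at hy
    rw [abs_lt]
    split_ifs at hy <;> constructor <;> linarith [hy.1, hy.2]
  have hinner : ∀ k ∈ s, ∀ y ∈ I k, |y| ≤ |u k| := fun k hk y hy => by
    have h := hu k hk
    simp only [hI] at hy
    split_ifs at hy with h0
    · rw [abs_of_pos h0] at h ⊢
      rw [abs_le]
      constructor <;> linarith [hy.1, hy.2]
    · rw [abs_of_nonpos (not_lt.1 h0)] at h ⊢
      rw [abs_le]
      constructor <;> linarith [hy.1, hy.2]
  have hdisj : (s : Set ι).Pairwise (Function.onFun Disjoint I) := fun j hj k hk hjk => by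
    refine Set.disjoint_left.2 fun y hyj hyk => ?_
    have h := hsep j hj k hk hjk
    have h1 := hnear j y hyj
    have h2 := hnear k y hyk
    have h3 := abs_sub_le (u j) y (u k)
    rw [abs_sub_comm (u j) y] at h3
    linarith
  calc δ / 2 * ∑ k ∈ s, F |u k| = ∑ k ∈ s, δ / 2 * F |u k| := Finset.mul_sum ..
    _ ≤ ∑ k ∈ s, ∫ y in I k, F |y| := by
      refine Finset.sum_le_sum fun k hk => ?_
      have h := setIntegral_ge_of_const_le (μ := volume) (c := F |u k|) (hmeas k)
        (by rw [hvol]; exact ENNReal.ofReal_ne_top)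
        (fun y hy => hF (mem_Ici.2 (abs_nonneg y)) (mem_Ici.2 (abs_nonneg (u k)))
          (hinner k hk y hy)) hint.integrableOn
      rwa [Measure.real, hvol, ENNReal.toReal_ofReal (by positivity), smul_eq_mul] at h
    _ = ∫ y in ⋃ k ∈ s, I k, F |y| :=
      (integral_biUnion_finset s (fun k _ => hmeas k) hdisj fun _ _ => hint.integrableOn).symm
    _ ≤ ∫ y, F |y| :=
      setIntegral_le_integral hint (Filter.Eventually.of_forall fun y => hF0 _ (abs_nonneg y))

/-- Cauchy–Schwarz for a weighted sum, with weights of total mass at most `C`. -/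
theorem summable_and_sq_tsum_le_of_weights {ι : Type*} {w b : ι → ℝ} {C : ℝ}
    (hw : ∀ k, 0 ≤ w k) (hws : Summable w) (hC : ∑' k, w k ≤ C) (hb : ∀ k, 0 ≤ b k)
    (hwb : Summable fun k => w k * b k ^ 2) :
    Summable (fun k => w k * b k) ∧ (∑' k, w k * b k) ^ 2 ≤ C * ∑' k, w k * b k ^ 2 := by
  have hs : Summable fun k => w k * b k := by
    refine Summable.of_nonneg_of_le (fun k => mul_nonneg (hw k) (hb k)) (fun k => ?_)
      (hws.add hwb)
    nlinarith [mul_nonneg (hw k) (sq_nonneg (b k - 1)), mul_nonneg (hw k) (hb k)]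
  refine ⟨hs, le_of_tendsto' (hs.hasSum.pow 2) fun s => ?_⟩
  have hnn : ∀ k, 0 ≤ w k * b k ^ 2 := fun k => mul_nonneg (hw k) (sq_nonneg _)
  calc (∑ k ∈ s, w k * b k) ^ 2 ≤ (∑ k ∈ s, w k) * ∑ k ∈ s, w k * b k ^ 2 :=
        Finset.sum_sq_le_sum_mul_sum_of_sq_le_mul s (fun k _ => hw k) (fun k _ => hnn k)
          fun k _ => le_of_eq (by ring)
    _ ≤ C * ∑' k, w k * b k ^ 2 :=
        mul_le_mul ((hws.sum_le_tsum s fun k _ => hw k).trans hC)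
          (hwb.sum_le_tsum s fun k _ => hnn k) (Finset.sum_nonneg fun k _ => hnn k)
          ((tsum_nonneg hw).trans hC)

theorem lp_two_summable_sq {ι : Type*} (a : lp (fun _ : ι => ℂ) 2) :
    Summable fun k => ‖a k‖ ^ 2 := by
  simpa using (lp.memℓp a).summable (by simp)

theorem lp_two_norm_sq {ι : Type*} (a : lp (fun _ : ι => ℂ) 2) :
    ‖a‖ ^ 2 = ∑' k, ‖a k‖ ^ 2 := by
  simpa using lp.norm_rpow_eq_tsum (p := 2) (by simp) a

section Schur

variable {ι : Type*} {K : ι → ι → ℝ} {C : ℝ}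

theorem schur_row_summable_and_sq_norm_le (hK : ∀ j k, 0 ≤ K j k)
    (hsymm : ∀ j k, K j k = K k j) (hsum : ∀ j, Summable (K j)) (hC : ∀ j, ∑' k, K j k ≤ C)
    (a : lp (fun _ : ι => ℂ) 2) :
    (∀ j, Summable fun k => (K j k : ℂ) * a k) ∧
      Summable (fun j => ‖∑' k, (K j k : ℂ) * a k‖ ^ 2) ∧
      ∑' j, ‖∑' k, (K j k : ℂ) * a k‖ ^ 2 ≤ C ^ 2 * ‖a‖ ^ 2 := by
  have ha := lp_two_summable_sq a
  have hcol : ∀ k, ∑' j, K k j * ‖a k‖ ^ 2 ≤ C * ‖a k‖ ^ 2 := fun k => by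
    rw [tsum_mul_right]
    exact mul_le_mul_of_nonneg_right (hC k) (sq_nonneg _)
  have hprod : Summable fun p : ι × ι => K p.1 p.2 * ‖a p.1‖ ^ 2 := by
    refine (summable_prod_of_nonneg fun p => mul_nonneg (hK p.1 p.2) (sq_nonneg ‖a p.1‖)).2
      ⟨fun k => (hsum k).mul_right (‖a k‖ ^ 2), ?_⟩
    exact Summable.of_nonneg_of_le
      (fun k => tsum_nonneg fun j => mul_nonneg (hK k j) (sq_nonneg ‖a k‖)) hcol (ha.mul_left C)
  have hswap : Summable fun p : ι × ι => K p.1 p.2 * ‖a p.2‖ ^ 2 := by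
    refine Summable.congr (f := fun p : ι × ι => K p.2 p.1 * ‖a p.2‖ ^ 2) hprod.prod_symm
      fun p => ?_
    rw [hsymm]
  have htotal : ∑' j, ∑' k, K j k * ‖a k‖ ^ 2 ≤ C * ‖a‖ ^ 2 := by
    have hcomm : ∑' j, ∑' k, K j k * ‖a k‖ ^ 2 = ∑' k, ∑' j, K k j * ‖a k‖ ^ 2 := by
      rw [← Summable.tsum_comm (f := fun k j => K k j * ‖a k‖ ^ 2) hprod]
      exact tsum_congr fun j => tsum_congr fun k => by rw [hsymm]
    rw [hcomm, lp_two_norm_sq, ← tsum_mul_left]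
    exact Summable.tsum_le_tsum hcol hprod.prod (ha.mul_left C)
  have hrow := fun j => summable_and_sq_tsum_le_of_weights (hK j) (hsum j) (hC j)
    (fun k => norm_nonneg (a k)) (hswap.prod_factor j)
  have hnorm : ∀ j k, ‖(K j k : ℂ) * a k‖ = K j k * ‖a k‖ := fun j k => by
    rw [norm_mul, Complex.norm_real, Real.norm_of_nonneg (hK j k)]
  have hbound : ∀ j, ‖∑' k, (K j k : ℂ) * a k‖ ^ 2 ≤ C * ∑' k, K j k * ‖a k‖ ^ 2 := fun j => by
    refine le_trans (pow_le_pow_left₀ (norm_nonneg _) ?_ 2) (hrow j).2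
    have h := norm_tsum_le_tsum_norm (f := fun k => (K j k : ℂ) * a k)
      ((hrow j).1.congr fun k => (hnorm j k).symm)
    simpa only [hnorm] using h
  have hs : Summable fun j => C * ∑' k, K j k * ‖a k‖ ^ 2 := hswap.prod.mul_left C
  refine ⟨fun j => ((hrow j).1.congr fun k => (hnorm j k).symm).of_norm,
    Summable.of_nonneg_of_le (fun j => sq_nonneg _) hbound hs, ?_⟩
  rcases isEmpty_or_nonempty ι with hι | ⟨⟨j₀⟩⟩
  · rw [tsum_empty]
    positivity
  have hC0 : 0 ≤ C := (tsum_nonneg (hK j₀)).trans (hC j₀)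
  calc ∑' j, ‖∑' k, (K j k : ℂ) * a k‖ ^ 2 ≤ ∑' j, C * ∑' k, K j k * ‖a k‖ ^ 2 :=
        (Summable.of_nonneg_of_le (fun j => sq_nonneg _) hbound hs).tsum_le_tsum hbound hs
    _ = C * ∑' j, ∑' k, K j k * ‖a k‖ ^ 2 := tsum_mul_left
    _ ≤ C * (C * ‖a‖ ^ 2) := mul_le_mul_of_nonneg_left htotal hC0
    _ = C ^ 2 * ‖a‖ ^ 2 := by ring

/-- Schur's test for a symmetric nonnegative matrix acting on `ℓ²`. -/
theorem exists_clm_of_schur (hC0 : 0 ≤ C) (hK : ∀ j k, 0 ≤ K j k)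
    (hsymm : ∀ j k, K j k = K k j) (hsum : ∀ j, Summable (K j)) (hC : ∀ j, ∑' k, K j k ≤ C) :
    ∃ S : lp (fun _ : ι => ℂ) 2 →L[ℂ] lp (fun _ : ι => ℂ) 2, ‖S‖ ≤ C ∧
      ∀ (a : lp (fun _ : ι => ℂ) 2) (j : ι),
        (S a : ∀ _ : ι, ℂ) j = ∑' k, (K j k : ℂ) * a k := by
  have key := schur_row_summable_and_sq_norm_le hK hsymm hsum hC
  let L : lp (fun _ : ι => ℂ) 2 →ₗ[ℂ] lp (fun _ : ι => ℂ) 2 :=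
    { toFun := fun a => ⟨fun j => ∑' k, (K j k : ℂ) * a k,
        memℓp_gen (by simpa using (key a).2.1)⟩
      map_add' := fun a b => by
        ext j
        simp only [lp.coeFn_add, Pi.add_apply, mul_add]
        exact ((key a).1 j).tsum_add ((key b).1 j)
      map_smul' := fun c a => by
        ext j
        simp only [lp.coeFn_smul, Pi.smul_apply, smul_eq_mul, RingHom.id_apply]
        rw [← tsum_mul_left]
        exact tsum_congr fun k => by ring }
  refine ⟨L.mkContinuous C fun a => ?_, L.mkContinuous_norm_le hC0 _, fun a j => rfl⟩
  refine (sq_le_sq₀ (norm_nonneg _) (by positivity)).1 ?_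
  rw [mul_pow, lp_two_norm_sq]
  exact (key a).2.2

end Schur

theorem inverse_multiquadric_schoenberg_invertible (β : ℝ) (hβ : 1 / 2 < β)
    (x : ℕ → ℝ) (δ : ℝ)
    (hsep : ∀ j k : ℕ, j ≠ k → δ ≤ |x j - x k|)
    (hδ : 2 * matBeta (β - 1 / 2) (1 / 2) < δ)
    (θ : ℝ) (hθ : θ = 2 * matBeta (β - 1 / 2) (1 / 2) / δ) :
    θ < 1 ∧
      (∀ a : ℕ → ℂ, Summable (fun j : ℕ => ‖a j‖ ^ 2) →
        (1 - θ) * (∑' j : ℕ, ‖a j‖ ^ 2) ≤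
          (∑' j : ℕ, ∑' k : ℕ,
            (((1 + |x j - x k| ^ 2) ^ (-β) : ℝ) : ℂ) * a j * (starRingEnd ℂ) (a k)).re) ∧
      ∃ T : lp (fun _ : ℕ => ℂ) 2 ≃L[ℂ] lp (fun _ : ℕ => ℂ) 2,
        ∀ (a : lp (fun _ : ℕ => ℂ) 2) (j : ℕ),
          (T a : ∀ _ : ℕ, ℂ) j =
            ∑' k : ℕ, (((1 + |x j - x k| ^ 2) ^ (-β) : ℝ) : ℂ) * a k := by
  set B := matBeta (β - 1 / 2) (1 / 2) with hB
  have hBint := integral_one_add_sq_abs_rpow_neg β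
  have hB0 : 0 ≤ B := by
    rw [hB, ← hBint]
    exact integral_nonneg fun y => by positivity
  have hδ0 : 0 < δ := by linarith
  have hθ1 : θ < 1 := by rwa [hθ, div_lt_one hδ0]
  have hθ0 : 0 ≤ θ := by rw [hθ]; positivity
  set A : ℕ → ℕ → ℝ := fun j k => (1 + |x j - x k| ^ 2) ^ (-β) with hA
  have hA0 : ∀ j k, 0 ≤ A j k := fun j k => by simp only [hA]; positivity
  let K : ℕ → ℕ → ℝ := fun j k => if k = j then 0 else A j k
  have hK : ∀ j k, 0 ≤ K j k := fun j k => by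
    simp only [K]; split_ifs; exacts [le_rfl, hA0 j k]
  have hsymm : ∀ j k, K j k = K k j := fun j k => by
    simp only [K, hA, eq_comm (a := k), abs_sub_comm (x j)]
  have hF : AntitoneOn (fun r : ℝ => (1 + r ^ 2) ^ (-β)) (Ici 0) := fun r hr t _ hrt =>
    Real.rpow_le_rpow_of_nonpos (by positivity)
      (by have := pow_le_pow_left₀ (mem_Ici.1 hr) hrt 2; linarith) (by linarith)
  have hfin : ∀ j (s : Finset ℕ), ∑ k ∈ s, K j k ≤ θ := fun j s => by
    have h := sum_le_integral_of_separated (s.filter fun k => k ≠ j) (fun k => x j - x k) hF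
      (fun r _ => by positivity) (integrable_one_add_sq_abs_rpow_neg hβ) hδ0
      (fun k hk => by
        have := hsep j k (Finset.mem_filter.1 hk).2.symm
        linarith)
      (fun k _ l _ hkl => by
        rw [sub_sub_sub_cancel_left, abs_sub_comm]
        exact hsep k l hkl)
    rw [hBint, Finset.sum_filter] at h
    have hsum : ∑ k ∈ s, K j k = ∑ k ∈ s, if k ≠ j then A j k else 0 :=
      Finset.sum_congr rfl fun k _ => by simp only [K, ite_not]
    rw [hsum, hθ, le_div_iff₀ hδ0]
    linarith
  have hsum : ∀ j, Summable (K j) := fun j => summable_of_sum_le (hK j) (hfin j)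
  have hC : ∀ j, ∑' k, K j k ≤ θ := fun j => (hsum j).tsum_le_of_sum_le (hfin j)
  obtain ⟨S, hSn, hS⟩ := exists_clm_of_schur hθ0 hK hsymm hsum hC
  have hrow := fun a => (schur_row_summable_and_sq_norm_le hK hsymm hsum hC a).1
  have hAS : ∀ (a : lp (fun _ : ℕ => ℂ) 2) (j : ℕ),
      HasSum (fun k => (A j k : ℂ) * a k) (a j + (S a : ∀ _ : ℕ, ℂ) j) := fun a j => by
    rw [hS]
    convert (hasSum_ite_eq j (a j)).add (hrow a j).hasSum using 2 with k
    by_cases hk : k = j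
    · subst hk
      simp [K, hA]
    · simp [K, hk]
  refine ⟨hθ1, fun a ha => ?_, ?_⟩
  · let v : lp (fun _ : ℕ => ℂ) 2 := ⟨a, memℓp_gen (by simpa using ha)⟩
    have hform : ∑' j, ∑' k, (A j k : ℂ) * a j * (starRingEnd ℂ) (a k) =
        inner ℂ (v + S v) v := by
      rw [lp.inner_eq_tsum]
      refine tsum_congr fun j => ?_
      have h := ((hAS v j).star).mul_left (a j)
      refine Eq.trans (tsum_congr fun k => ?_) (h.tsum_eq.trans ?_)
      · simp [v]
        ring
      · change a j * star (v j + (S v : ∀ _ : ℕ, ℂ) j) = inner ℂ (v j + (S v : ∀ _ : ℕ, ℂ) j) (v j)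
        rw [RCLike.inner_apply]
        rfl
    have hre : -(θ * ‖v‖ ^ 2) ≤ (inner ℂ (S v) v).re := by
      have h1 : ‖inner ℂ (S v) v‖ ≤ θ * ‖v‖ ^ 2 :=
        calc ‖inner ℂ (S v) v‖ ≤ ‖S v‖ * ‖v‖ := norm_inner_le_norm _ _
          _ ≤ θ * ‖v‖ * ‖v‖ :=
            mul_le_mul_of_nonneg_right (S.le_of_opNorm_le hSn v) (norm_nonneg _)
          _ = θ * ‖v‖ ^ 2 := by ring
      exact (abs_le.1 ((Complex.abs_re_le_norm _).trans h1)).1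
    have hv : ∑' j, ‖a j‖ ^ 2 = ‖v‖ ^ 2 := (lp_two_norm_sq v).symm
    have hvv : (inner ℂ v v).re = ‖v‖ ^ 2 := inner_self_eq_norm_sq (𝕜 := ℂ) v
    rw [hform, hv, inner_add_left, Complex.add_re, hvv]
    linarith
  · refine ⟨ContinuousLinearEquiv.unitsEquiv ℂ _
      (Units.oneSub (-S) (by rw [norm_neg]; exact hSn.trans_lt hθ1)), fun a j => ?_⟩
    rw [(hAS a j).tsum_eq, ContinuousLinearEquiv.unitsEquiv_apply, Units.val_oneSub]
    simp
end
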